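/- Let X be an O-regular compact set in C^n (O_X is closed), let phi be a real-valued continuous function on B_X, and define u = sup{ v : v in PSH^c(X), v <= phi on B_X }. Then u is the unique weakly plurisubharmonic function on X that is maximal on X and equal to phi on B_X: if v in PSH^w(X) is maximal and v = phi on B_X, then v = u. -/

import Mathlib

open MeasureTheory Metric Filter Topology Set Complex
open scoped ENNReal

noncomputable section

/-- `ℂⁿ`. -/
abbrev En (n : ℕ) : Type := EuclideanSpace ℂ (Fin n)

instance (n : ℕ) : MeasurableSpace (En n) := borel _

instance (n : ℕ) : BorelSpace (En n) := ⟨rfl⟩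

open Classical in
/-- The positive part of an extended real number, as an element of `ℝ≥0∞`. -/
def epos (x : EReal) : ℝ≥0∞ := if x = ⊤ then ⊤ else ENNReal.ofReal x.toReal

/-- The integral of an `EReal`-valued function `u` against a measure `μ`, defined as the
difference of the lower integrals of the positive and negative parts of `u`. -/
def eint {α : Type*} [MeasurableSpace α] (μ : Measure α) (u : α → EReal) : EReal :=
  ((∫⁻ x, epos (u x) ∂μ : ℝ≥0∞) : EReal) - ((∫⁻ x, epos (-(u x)) ∂μ : ℝ≥0∞) : EReal)

/-- The normalized angular measure `(2π)⁻¹ dθ` on `[0, 2π)`. -/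
def thetaM : Measure ℝ :=
  (ENNReal.ofReal ((2 * Real.pi)⁻¹)) • (volume.restrict (Set.Ico (0 : ℝ) (2 * Real.pi)))

/-- A function `u` with values in `[-∞, ∞)` is plurisubharmonic on an open set `U ⊆ ℂⁿ`:
it is upper semicontinuous, `< ⊤`, and satisfies the sub-mean-value inequality on every
complex line. -/
def PshOnE {n : ℕ} (u : En n → EReal) (U : Set (En n)) : Prop :=
  UpperSemicontinuousOn u U ∧ (∀ z ∈ U, u z < ⊤) ∧
  ∀ z ∈ U, ∀ w : En n, ∀ r : ℝ, 0 < r →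
    (∀ ζ : ℂ, ‖ζ‖ ≤ r → z + ζ • w ∈ U) →
    u z ≤ eint thetaM (fun θ => u (z + (circleMap 0 r θ) • w))

/-- `μ` is a Jensen measure on `X` with barycenter `z`:  a Borel probability measure
supported on `X` such that `u z ≤ ∫ u dμ` for every function `u` continuous and
plurisubharmonic on some open neighborhood of `X`. -/
def IsJensen {n : ℕ} (X : Set (En n)) (z : En n) (μ : Measure (En n)) : Prop :=
  IsProbabilityMeasure μ ∧ μ Xᶜ = 0 ∧
  ∀ U : Set (En n), IsOpen U → X ⊆ U →
    ∀ u : En n → EReal, ContinuousOn u U → PshOnE u U → u z ≤ eint μ u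

/-- `u : X → [-∞, ∞)` is plurisubharmonic on the compact set `X` : it is upper
semicontinuous on `X`, `< ⊤` on `X`, and satisfies the subaveraging inequality with respect
to all Jensen measures on `X`. -/
def PSHe {n : ℕ} (X : Set (En n)) (u : En n → EReal) : Prop :=
  UpperSemicontinuousOn u X ∧ (∀ z ∈ X, u z < ⊤) ∧
  ∀ z ∈ X, ∀ μ : Measure (En n), IsJensen X z μ → u z ≤ eint μ u

/-- `PSH^c(X)`: continuous plurisubharmonic functions on `X`. -/
def PSHce {n : ℕ} (X : Set (En n)) (u : En n → EReal) : Prop :=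
  PSHe X u ∧ ContinuousOn u X

/-- Real-valued continuous plurisubharmonic functions on `X`. -/
def PSHcR {n : ℕ} (X : Set (En n)) (u : En n → ℝ) : Prop :=
  ContinuousOn u X ∧ PSHe X (fun x => (u x : EReal))

/-- `O_X`: the set of points `z ∈ X` whose only Jensen measure is `δ_z`. -/
def Oset {n : ℕ} (X : Set (En n)) : Set (En n) :=
  {z | z ∈ X ∧ ∀ μ : Measure (En n), IsJensen X z μ → μ = Measure.dirac z}

/-- The potential boundary `B_X`, the closure of `O_X`. -/
def Bset {n : ℕ} (X : Set (En n)) : Set (En n) := closure (Oset X)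

/-- `J^b_z(X)`: Jensen measures with barycenter `z` supported on `B_X`. -/
def IsJensenB {n : ℕ} (X : Set (En n)) (z : En n) (μ : Measure (En n)) : Prop :=
  IsJensen X z μ ∧ μ (Bset X)ᶜ = 0

/-- `ν` is subordinated to `μ` : `μ(u) ≥ ν(u)` for all `u ∈ PSH^c(X)`. -/
def Subord {n : ℕ} (X : Set (En n)) (μ ν : Measure (En n)) : Prop :=
  ∀ u : En n → EReal, PSHce X u → eint ν u ≤ eint μ u

/-- Subharmonic functions with values in `[-∞, ∞)` on an open set `U ⊆ ℂ`. -/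
def SubharmOn (u : ℂ → EReal) (U : Set ℂ) : Prop :=
  UpperSemicontinuousOn u U ∧ (∀ z ∈ U, u z < ⊤) ∧
  ∀ z ∈ U, ∀ r : ℝ, 0 < r → closedBall z r ⊆ U →
    u z ≤ eint thetaM (fun θ => u (circleMap z r θ))

/-- Harmonic (real-valued) functions on an open set `U ⊆ ℂ`: continuous functions
satisfying the mean-value equality. -/
def HarmOn (h : ℂ → ℝ) (U : Set ℂ) : Prop :=
  ContinuousOn h U ∧
  ∀ z ∈ U, ∀ r : ℝ, 0 < r → closedBall z r ⊆ U →
    h z = (2 * Real.pi)⁻¹ * ∫ θ in (0 : ℝ)..(2 * Real.pi), h (circleMap z r θ)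

/-- Superharmonic (real-valued) functions on an open set `U ⊆ ℂ`. -/
def SuperharmOn (v : ℂ → ℝ) (U : Set ℂ) : Prop :=
  LowerSemicontinuousOn v U ∧
  ∀ z ∈ U, ∀ r : ℝ, 0 < r → closedBall z r ⊆ U →
    (2 * Real.pi)⁻¹ * (∫ θ in (0 : ℝ)..(2 * Real.pi), v (circleMap z r θ)) ≤ v z

/-- The infimum of all positive superharmonic functions on the unit disk, extending
continuously to the closed disk and `≥ 1` on `A`, evaluated at `z`. -/
def hmPre (A : Set ℂ) (z : ℂ) : ℝ :=
  sInf {t : ℝ | ∃ v : ℂ → ℝ, SuperharmOn v (ball 0 1) ∧ (∀ w ∈ ball (0 : ℂ) 1, 0 < v w) ∧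
    ContinuousOn v (closedBall 0 1) ∧ (∀ w ∈ A, 1 ≤ v w) ∧ t = v z}

/-- The harmonic measure `ω(z, A, 𝔻)` of `A` with respect to the unit disk. -/
def hm (z : ℂ) (A : Set ℂ) : ℝ := Filter.liminf (fun w => hmPre A w) (𝓝 z)

open Classical in
/-- The radial limit of a map `f` at the boundary point `ζ` of the unit circle
(junk value `0` if the radial limit does not exist). -/
def bval {n : ℕ} (f : ℂ → En n) (ζ : ℂ) : En n :=
  if h : ∃ l : En n, Tendsto (fun r : ℝ => f ((r : ℂ) * ζ)) (𝓝[<] (1 : ℝ)) (𝓝 l)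
  then h.choose else 0

open Classical in
/-- The radial limit of an `EReal`-valued function on the disk at the boundary point `ζ`. -/
def bvalE (g : ℂ → EReal) (ζ : ℂ) : EReal :=
  if h : ∃ l : EReal, Tendsto (fun r : ℝ => g ((r : ℂ) * ζ)) (𝓝[<] (1 : ℝ)) (𝓝 l)
  then h.choose else 0

/-- `μ_f`: the push-forward of the normalized arclength measure on the unit circle under the
radial boundary values of `f`. -/
def bmeas {n : ℕ} (f : ℂ → En n) : Measure (En n) :=
  thetaM.map (fun θ => bval f (circleMap 0 1 θ))

/-- Weak-* convergence of a sequence of measures on `ℂⁿ`. -/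
def WeakConv {n : ℕ} (μs : ℕ → Measure (En n)) (μ : Measure (En n)) : Prop :=
  ∀ φ : BoundedContinuousFunction (En n) ℝ,
    Tendsto (fun j => ∫ x, φ x ∂(μs j)) atTop (𝓝 (∫ x, φ x ∂μ))

/-- The cluster set `cl L` of a sequence of maps of the unit disk into `ℂⁿ`. -/
def clusterSet {n : ℕ} (f : ℕ → ℂ → En n) : Set (En n) :=
  {z | ∀ r : ℝ, 0 < r → ∀ N : ℕ, ∃ j, N ≤ j ∧ ∃ ζ ∈ ball (0 : ℂ) 1, f j ζ ∈ ball z r}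

/-- A point `z` is totally essential for the sequence `f` if for every open set `V ∋ z` the
harmonic measures at `0` of `f j ⁻¹' V` stay bounded away from `0`. -/
def TotallyEssential {n : ℕ} (f : ℕ → ℂ → En n) (z : En n) : Prop :=
  ∀ V : Set (En n), IsOpen V → z ∈ V →
    0 < Filter.atTop.liminf (fun j => hm 0 ((f j ⁻¹' V) ∩ ball 0 1))

/-- A totally perfect sequence `L` of holomorphic maps of the unit disk into `ℂⁿ`: a
uniformly bounded sequence of holomorphic maps which is weak-* converging (with limit measure
`μ_L` and center `z_L`) and all of whose cluster points are totally essential. -/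
structure PerfectSeq (n : ℕ) where
  f : ℕ → ℂ → En n
  holo : ∀ j, DifferentiableOn ℂ (f j) (ball 0 1)
  bdd : ∃ C : ℝ, ∀ j, ∀ ζ ∈ ball (0 : ℂ) 1, ‖f j ζ‖ ≤ C
  μL : Measure (En n)
  conv : WeakConv (fun j => bmeas (f j)) μL
  zL : En n
  center : Tendsto (fun j => f j 0) atTop (𝓝 zL)
  ess : ∀ z ∈ clusterSet f, TotallyEssential f z

/-- `J_z^s(L)`: the measures obtained as weak-* limits of `μ_{f_{j_k} ∘ g_k}` for subsequences
`{j_k}` and holomorphic maps `g_k : 𝔻 → 𝔻` with `f_{j_k}(g_k(0)) → z`. -/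
def JsSet {n : ℕ} (L : PerfectSeq n) (z : En n) : Set (Measure (En n)) :=
  {μ | ∃ jk : ℕ → ℕ, StrictMono jk ∧ ∃ g : ℕ → ℂ → ℂ,
    (∀ k, DifferentiableOn ℂ (g k) (ball 0 1) ∧ MapsTo (g k) (ball 0 1) (ball 0 1)) ∧
    WeakConv (fun k => bmeas ((L.f (jk k)) ∘ (g k))) μ ∧
    Tendsto (fun k => L.f (jk k) (g k 0)) atTop (𝓝 z)}

/-- `J_z(L)`: the convex hull of `J_z^s(L)`. -/
def JLSet {n : ℕ} (L : PerfectSeq n) (z : En n) : Set (Measure (En n)) :=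
  {μ | ∃ (m : ℕ) (w : Fin m → ℝ) (ν : Fin m → Measure (En n)),
    (∀ i, 0 ≤ w i) ∧ (∑ i, w i = 1) ∧ (∀ i, ν i ∈ JsSet L z) ∧
    μ = ∑ i, (ENNReal.ofReal (w i)) • ν i}

/-- `u` is harmonic on the totally perfect sequence `L`. -/
def HarmonicOnL {n : ℕ} (L : PerfectSeq n) (u : En n → EReal) : Prop :=
  PSHce (clusterSet L.f) u ∧
  ∀ z ∈ clusterSet L.f, ∀ μ ∈ JLSet L z, eint μ u = u z

/-- `PSH^w(X)`: weakly plurisubharmonic functions, the upper envelopes of nonempty families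
of continuous plurisubharmonic functions on `X`. -/
def PSHw {n : ℕ} (X : Set (En n)) (u : En n → EReal) : Prop :=
  ∃ F : Set (En n → EReal), F.Nonempty ∧ (∀ v ∈ F, PSHce X v) ∧
    ∀ x ∈ X, u x = ⨆ v ∈ F, v x

/-- `u` is maximal on `X ∖ Z`: for every relatively open `V ⊆ X ∖ Z` and every
`v ∈ PSH^c(closure V)`, if `v ≤ u` on the relative boundary of `V` in `X` then `v ≤ u`
on `closure V`. -/
def MaximalOn {n : ℕ} (X Z : Set (En n)) (u : En n → EReal) : Prop :=
  ∀ W : Set (En n), IsOpen W → X ∩ W ⊆ X \ Z →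
    ∀ v : En n → EReal, PSHce (closure (X ∩ W)) v →
      (∀ x ∈ closure (X ∩ W) \ (X ∩ W), v x ≤ u x) →
      ∀ x ∈ closure (X ∩ W), v x ≤ u x

/-- Pluriharmonic continuous real-valued functions on `X`. -/
def Pluriharm {n : ℕ} (X : Set (En n)) (h : En n → ℝ) : Prop :=
  ContinuousOn h X ∧
  ∀ z ∈ X, ∀ μ : Measure (En n), IsJensen X z μ → (h z : EReal) = eint μ (fun x => (h x : EReal))

/-- `X` is a Poisson set: every continuous real-valued function on `B_X` extends to a
pluriharmonic function on `X`. -/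
def PoissonSet {n : ℕ} (X : Set (En n)) : Prop :=
  ∀ φ : En n → ℝ, ContinuousOn φ (Bset X) →
    ∃ h : En n → ℝ, Pluriharm X h ∧ ∀ w ∈ Bset X, h w = φ w

end

/-- Trigonometric polynomials are dense: a continuous function on the unit circle is uniformly
close to the real part of an entire function. -/
lemma exists_entire_re_close {G : ℂ → ℝ} (hG : ContinuousOn G (sphere 0 1)) {ε : ℝ}
    (hε : 0 < ε) :
    ∃ P : ℂ → ℂ, Differentiable ℂ P ∧ ∀ ζ ∈ sphere (0 : ℂ) 1, |G ζ - (P ζ).re| < ε := by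
  have : Fact ((0 : ℝ) < 1) := ⟨one_pos⟩
  let F : C(AddCircle (1 : ℝ), ℂ) :=
    ⟨fun x => ((G (AddCircle.toCircle x : ℂ) : ℝ) : ℂ), by
      refine Complex.continuous_ofReal.comp ?_
      exact hG.comp_continuous (continuous_subtype_val.comp AddCircle.continuous_toCircle)
        (fun x => by simpa using Circle.norm_coe (AddCircle.toCircle x))⟩
  have hF : F ∈ (Submodule.span ℂ (range <| @fourier 1)).topologicalClosure := by
    rw [span_fourier_closure_eq_top]; trivial
  obtain ⟨f, hf, hd⟩ := Metric.mem_closure_iff.1 hF ε hε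
  have key : ∀ f ∈ Submodule.span ℂ (range <| @fourier 1), ∃ P Q : ℂ → ℂ, Differentiable ℂ P ∧
      Differentiable ℂ Q ∧ ∀ x, f x = P (AddCircle.toCircle x) +
        starRingEnd ℂ (Q (AddCircle.toCircle x)) := by
    intro f hf
    induction hf using Submodule.span_induction with
    | mem f hf =>
      obtain ⟨k, rfl⟩ := hf
      have hm : ∀ (m : ℕ) (x : AddCircle (1 : ℝ)),
          fourier (m : ℤ) x = (AddCircle.toCircle x : ℂ) ^ m := fun m x => by
        rw [fourier_apply, natCast_zsmul, AddCircle.toCircle_nsmul, Circle.coe_pow]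
      obtain ⟨m, rfl | rfl⟩ := k.eq_nat_or_neg
      · exact ⟨fun z => z ^ m, 0, by fun_prop, differentiable_const 0, fun x => by simp [hm]⟩
      · exact ⟨0, fun z => z ^ m, differentiable_const 0, by fun_prop,
          fun x => by rw [fourier_neg, hm]; simp⟩
    | zero => exact ⟨0, 0, differentiable_const 0, differentiable_const 0, by simp⟩
    | add f g _ _ hf hg =>
      obtain ⟨P, Q, hP, hQ, h⟩ := hf
      obtain ⟨P', Q', hP', hQ', h'⟩ := hg
      refine ⟨P + P', Q + Q', hP.add hP', hQ.add hQ', fun x => ?_⟩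
      simp [h, h']; ring
    | smul c f _ hf =>
      obtain ⟨P, Q, hP, hQ, h⟩ := hf
      refine ⟨fun z => c * P z, fun z => starRingEnd ℂ c * Q z, by fun_prop, by fun_prop,
        fun x => ?_⟩
      simp [h]; ring
  obtain ⟨P, Q, hP, hQ, h⟩ := key f hf
  refine ⟨fun z => P z + Q z, hP.add hQ, fun ζ hζ => ?_⟩
  let c : Circle := ⟨ζ, hζ⟩
  obtain ⟨x, hx⟩ : ∃ x : AddCircle (1 : ℝ), (AddCircle.toCircle x : ℂ) = c := by
    obtain ⟨x, hx⟩ := (AddCircle.homeomorphCircle (T := (1 : ℝ)) one_ne_zero).surjective c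
    exact ⟨x, by rw [← hx, AddCircle.homeomorphCircle_apply]⟩
  replace hx : (AddCircle.toCircle x : ℂ) = ζ := hx
  have h1 : ‖F x - f x‖ < ε := by
    have := ContinuousMap.dist_lt_iff hε |>.1 hd x
    rwa [dist_eq_norm] at this
  have h2 := (Complex.abs_re_le_norm (F x - f x)).trans_lt h1
  rw [h x] at h2
  simpa [F, hx] using h2

lemma circleAverage_re_entire {P : ℂ → ℂ} (hP : Differentiable ℂ P) (c : ℂ) (r : ℝ) :
    Real.circleAverage (fun z => (P z).re) c r = (P c).re := by
  have h1 : Real.circleAverage P c r = P c := (hP.diffContOnCl).circleAverage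
  have h2 := Complex.reCLM.circleAverage_comp_comm (f := P) (c := c) (R := r)
    (hP.continuous.continuousOn.circleIntegrable')
  rw [h1] at h2
  exact h2

lemma circleAverage_normSq (c : ℂ) (r : ℝ) :
    Real.circleAverage (fun z => Complex.normSq z) c r = Complex.normSq c + r ^ 2 := by
  have h : Set.EqOn (fun z => Complex.normSq z)
      (fun z => (2 * starRingEnd ℂ c * z).re + (r ^ 2 - Complex.normSq c)) (sphere c |r|) := by
    intro z hz
    have hz' : Complex.normSq (z - c) = r ^ 2 := by
      rw [Complex.normSq_eq_norm_sq, ← dist_eq_norm, mem_sphere.1 hz, sq_abs]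
    simp only [Complex.normSq_apply, Complex.sub_re, Complex.sub_im, Complex.mul_re, Complex.mul_im,
      Complex.conj_re, Complex.conj_im, Complex.re_ofNat, Complex.im_ofNat] at hz' ⊢
    nlinarith
  have hd : Differentiable ℂ (fun z => 2 * starRingEnd ℂ c * z) := by fun_prop
  rw [Real.circleAverage_congr_sphere h, Real.circleAverage_fun_add, circleAverage_re_entire hd,
    Real.circleAverage_const]
  · simp only [Complex.normSq_apply, Complex.mul_re, Complex.mul_im,
      Complex.conj_re, Complex.conj_im, Complex.re_ofNat, Complex.im_ofNat]
    ring
  · exact (Complex.continuous_re.comp hd.continuous).continuousOn.circleIntegrable'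
  · exact continuousOn_const.circleIntegrable'

/-- The local sub-mean value property implies the global one. -/
lemma le_circleAverage_of_local {G : ℂ → ℝ} (hG : ContinuousOn G (closedBall 0 1))
    (hloc : ∀ ζ ∈ ball (0 : ℂ) 1, ∃ ρ > 0, ∀ r, 0 < r → r < ρ → G ζ ≤ Real.circleAverage G ζ r) :
    G 0 ≤ Real.circleAverage G 0 1 := by
  refine le_of_forall_pos_le_add fun ε hε => ?_
  have hGs : ContinuousOn G (sphere 0 1) := hG.mono sphere_subset_closedBall
  obtain ⟨P, hP, hPG⟩ := exists_entire_re_close hGs (ε := ε / 4) (by positivity)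
  have hPc : Continuous fun z => (P z).re := Complex.continuous_re.comp hP.continuous
  set H : ℂ → ℝ := fun ζ => G ζ - (P ζ).re + ε / 4 * Complex.normSq ζ with hH
  have hHc : ContinuousOn H (closedBall 0 1) :=
    (hG.sub hPc.continuousOn).add (continuousOn_const.mul Complex.continuous_normSq.continuousOn)
  obtain ⟨ζ, hζ, hmax⟩ := (isCompact_closedBall (0 : ℂ) 1).exists_isMaxOn
    ⟨0, by simp⟩ hHc
  have hbd : ζ ∈ sphere (0 : ℂ) 1 := by
    by_contra hns
    have hb : ζ ∈ ball (0 : ℂ) 1 := by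
      rw [mem_sphere] at hns
      exact mem_ball.2 (lt_of_le_of_ne hζ hns)
    obtain ⟨ρ, hρ, hsub⟩ := hloc ζ hb
    obtain ⟨δ, hδ, hδb⟩ := Metric.isOpen_iff.1 isOpen_ball ζ hb
    set r := min ρ δ / 2
    have hrp : 0 < r := by positivity
    have hrρ : r < ρ := (half_lt_self (lt_min hρ hδ)).trans_le (min_le_left _ _)
    have hrδ : r < δ := (half_lt_self (lt_min hρ hδ)).trans_le (min_le_right _ _)
    have hss : sphere ζ |r| ⊆ closedBall (0 : ℂ) 1 := by
      rw [abs_of_pos hrp]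
      exact (sphere_subset_closedBall.trans (closedBall_subset_ball hrδ)).trans
        (hδb.trans ball_subset_closedBall)
    have i1 : CircleIntegrable G ζ r := (hG.mono hss).circleIntegrable'
    have i2 : CircleIntegrable (fun z => (P z).re) ζ r := hPc.continuousOn.circleIntegrable'
    have i3 : CircleIntegrable (fun z => ε / 4 * Complex.normSq z) ζ r :=
      (continuousOn_const.mul Complex.continuous_normSq.continuousOn).circleIntegrable'
    have hle : Real.circleAverage H ζ r ≤ H ζ :=
      Real.circleAverage_mono_on_of_le_circle (hHc.mono hss).circleIntegrable'
        (fun x hx => hmax (hss hx))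
    have hav : Real.circleAverage H ζ r = Real.circleAverage G ζ r - (P ζ).re +
        ε / 4 * (Complex.normSq ζ + r ^ 2) := by
      have e3 : Real.circleAverage (fun z => ε / 4 * Complex.normSq z) ζ r =
          ε / 4 * (Complex.normSq ζ + r ^ 2) := by
        rw [← circleAverage_normSq]
        exact Real.circleAverage_fun_smul (a := ε / 4) (f := fun z => Complex.normSq z)
      have e12 : Real.circleAverage (fun z => G z - (P z).re) ζ r =
          Real.circleAverage G ζ r - (P ζ).re := by
        rw [Real.circleAverage_fun_sub i1 i2, circleAverage_re_entire hP]
      have := Real.circleAverage_fun_add (i1.sub i2) i3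
      exact this.trans (by rw [e3]; exact congrArg (· + _) e12)
    have h5 := hsub r hrp hrρ
    rw [hav] at hle
    simp only [hH] at hle
    nlinarith [mul_pos hε (pow_pos hrp 2)]
  have h1 := hPG ζ hbd
  have h0 : H 0 ≤ H ζ := hmax (by simp)
  have hn : Complex.normSq ζ = 1 := by
    rw [Complex.normSq_eq_norm_sq]; simp [mem_sphere_zero_iff_norm.1 hbd]
  simp only [hH, hn, map_zero] at h0
  have h2 : (P 0).re ≤ Real.circleAverage G 0 1 + ε / 4 := by
    rw [← circleAverage_re_entire hP 0 1, ← Real.circleAverage_const (ε / 4) 0 1,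
      ← Real.circleAverage_fun_add]
    · refine Real.circleAverage_mono hPc.continuousOn.circleIntegrable' ?_ ?_
      · refine ContinuousOn.circleIntegrable' ?_
        rw [abs_one]
        exact hGs.add continuousOn_const
      · intro x hx
        have := abs_lt.1 (hPG x (by simpa using hx))
        linarith
    · exact ContinuousOn.circleIntegrable' (by simpa using hGs)
    · exact continuousOn_const.circleIntegrable'
  have := abs_lt.1 h1
  linarith

/-- Continuous real-valued plurisubharmonic functions on `U`, tested on discs of parameter
radius one. -/
def PshR {n : ℕ} (U : Set (En n)) (g : En n → ℝ) : Prop :=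
  ContinuousOn g U ∧ ∀ z ∈ U, ∀ w : En n, (∀ ζ : ℂ, ‖ζ‖ ≤ 1 → z + ζ • w ∈ U) →
    g z ≤ Real.circleAverage (fun ζ => g (z + ζ • w)) 0 1

lemma continuousOn_disc {n : ℕ} {α : Type*} [TopologicalSpace α] {U : Set (En n)} {g : En n → α}
    (hg : ContinuousOn g U) {z w : En n} {r : ℝ} (h : ∀ ζ : ℂ, ‖ζ‖ ≤ r → z + ζ • w ∈ U) :
    ContinuousOn (fun ζ : ℂ => g (z + ζ • w)) (closedBall 0 r) :=
  hg.comp (by fun_prop) fun ζ hζ => h ζ (by simpa using hζ)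

lemma circleIntegrable_disc {n : ℕ} {U : Set (En n)} {g : En n → ℝ} (hg : ContinuousOn g U)
    {z w : En n} (h : ∀ ζ : ℂ, ‖ζ‖ ≤ 1 → z + ζ • w ∈ U) :
    CircleIntegrable (fun ζ : ℂ => g (z + ζ • w)) 0 1 := by
  refine ContinuousOn.circleIntegrable' ?_
  rw [abs_one]
  exact (continuousOn_disc hg h).mono sphere_subset_closedBall

namespace PshR

variable {n : ℕ} {U V : Set (En n)} {f g : En n → ℝ}

lemma const (U : Set (En n)) (c : ℝ) : PshR U fun _ => c :=
  ⟨continuousOn_const, fun _ _ _ _ => (Real.circleAverage_const c 0 1).ge⟩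

lemma mono (hg : PshR V g) (h : U ⊆ V) : PshR U g :=
  ⟨hg.1.mono h, fun z hz w hw => hg.2 z (h hz) w fun ζ hζ => h (hw ζ hζ)⟩

lemma add (hf : PshR U f) (hg : PshR U g) : PshR U fun x => f x + g x :=
  ⟨hf.1.add hg.1, fun z hz w hw => by
    rw [Real.circleAverage_fun_add (circleIntegrable_disc hf.1 hw) (circleIntegrable_disc hg.1 hw)]
    exact add_le_add (hf.2 z hz w hw) (hg.2 z hz w hw)⟩

lemma const_mul (hf : PshR U f) {c : ℝ} (hc : 0 ≤ c) : PshR U fun x => c * f x :=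
  ⟨continuousOn_const.mul hf.1, fun z hz w hw => by
    have := Real.circleAverage_fun_smul (a := c) (f := fun ζ : ℂ => f (z + ζ • w)) (c := 0) (R := 1)
    simp only [smul_eq_mul] at this
    rw [this]
    exact mul_le_mul_of_nonneg_left (hf.2 z hz w hw) hc⟩

lemma sup (hf : PshR U f) (hg : PshR U g) : PshR U fun x => max (f x) (g x) := by
  have hc : ContinuousOn (fun x => max (f x) (g x)) U := hf.1.sup hg.1
  refine ⟨hc, fun z hz w hw => max_le ?_ ?_⟩
  · exact (hf.2 z hz w hw).trans (Real.circleAverage_mono (circleIntegrable_disc hf.1 hw)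
      (circleIntegrable_disc hc hw) fun x _ => le_max_left _ _)
  · exact (hg.2 z hz w hw).trans (Real.circleAverage_mono (circleIntegrable_disc hg.1 hw)
      (circleIntegrable_disc hc hw) fun x _ => le_max_right _ _)

lemma congr (hf : PshR U f) (h : Set.EqOn g f U) : PshR U g :=
  ⟨hf.1.congr h, fun z hz w hw => by
    rw [h hz]
    refine (hf.2 z hz w hw).trans_eq (Real.circleAverage_congr_sphere fun ζ hζ => ?_)
    exact (h (hw ζ (by simpa using (mem_sphere_zero_iff_norm.1 hζ).le))).symm⟩

/-- Plurisubharmonicity is a local property. -/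
lemma of_local (h : ∀ z ∈ U, ∃ O, IsOpen O ∧ z ∈ O ∧ PshR O g) : PshR U g := by
  have hc : ContinuousOn g U := fun z hz => by
    obtain ⟨O, hO, hzO, hg⟩ := h z hz
    exact (hg.1.continuousAt (hO.mem_nhds hzO)).continuousWithinAt
  refine ⟨hc, fun z hz w hw => ?_⟩
  have := le_circleAverage_of_local (continuousOn_disc hc hw) ?_
  · simpa using this
  intro ζ hζ
  obtain ⟨O, hO, hzO, hg⟩ := h (z + ζ • w) (hw ζ (mem_ball_zero_iff.1 hζ).le)
  have hcont : Continuous fun ξ : ℂ => z + ζ • w + ξ • w := by fun_prop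
  obtain ⟨ρ, hρ, hρO⟩ := Metric.isOpen_iff.1 (hO.preimage hcont) 0 (by simpa using hzO)
  refine ⟨ρ, hρ, fun r hr hrρ => ?_⟩
  have h1 := hg.2 _ hzO ((r : ℂ) • w) fun ξ hξ => by
    have : ξ * r ∈ ball (0 : ℂ) ρ := by
      rw [mem_ball_zero_iff, norm_mul, Complex.norm_real, Real.norm_of_nonneg hr.le]
      nlinarith [norm_nonneg ξ]
    rw [smul_smul]
    exact hρO this
  refine h1.trans_eq ?_
  rw [Real.circleAverage_eq_circleAverage_zero_one (c := ζ) (R := r)]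
  congr 1
  funext ξ
  congr 1
  rw [smul_smul, add_assoc, ← add_smul]
  congr 2
  ring

end PshR

lemma epos_coe (x : ℝ) : epos (x : EReal) = ENNReal.ofReal x := by simp [epos]

lemma epos_mono : Monotone epos := by
  intro x y h
  unfold epos
  split_ifs with h1 h2 h2
  · exact le_rfl
  · exact absurd (top_le_iff.1 (h1 ▸ h)) h2
  · exact le_top
  · induction x with
    | bot => simp
    | top => exact absurd rfl h1
    | coe x =>
      induction y with
      | bot => simp at h
      | top => exact absurd rfl h2
      | coe y => exact ENNReal.ofReal_le_ofReal (by simpa using h)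

lemma eint_mono_ae {α : Type*} [MeasurableSpace α] {μ : Measure α} {u v : α → EReal}
    (h : ∀ᵐ x ∂μ, u x ≤ v x) : eint μ u ≤ eint μ v := by
  refine EReal.sub_le_sub ?_ ?_
  · exact EReal.coe_ennreal_le_coe_ennreal_iff.2 (lintegral_mono_ae (h.mono fun x hx => epos_mono hx))
  · exact EReal.coe_ennreal_le_coe_ennreal_iff.2
      (lintegral_mono_ae (h.mono fun x hx => epos_mono (EReal.neg_le_neg_iff.2 hx)))

lemma eint_congr_ae {α : Type*} [MeasurableSpace α] {μ : Measure α} {u v : α → EReal}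
    (h : ∀ᵐ x ∂μ, u x = v x) : eint μ u = eint μ v :=
  le_antisymm (eint_mono_ae (h.mono fun _ hx => hx.le)) (eint_mono_ae (h.mono fun _ hx => hx.ge))

lemma eint_coe {α : Type*} [MeasurableSpace α] {μ : Measure α} {f : α → ℝ} (hf : Integrable f μ) :
    eint μ (fun x => (f x : EReal)) = ((∫ x, f x ∂μ : ℝ) : EReal) := by
  have h1 : ∫⁻ x, ENNReal.ofReal (f x) ∂μ ≠ ⊤ := hf.lintegral_lt_top.ne
  have h2 : ∫⁻ x, ENNReal.ofReal (-f x) ∂μ ≠ ⊤ := hf.neg.lintegral_lt_top.ne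
  rw [integral_eq_lintegral_pos_part_sub_lintegral_neg_part hf, EReal.coe_sub, eint]
  simp only [← EReal.coe_neg, epos_coe]
  rw [EReal.coe_ennreal_toReal h1, EReal.coe_ennreal_toReal h2]

lemma integral_thetaM (f : ℝ → ℝ) :
    ∫ θ, f θ ∂thetaM = (2 * Real.pi)⁻¹ * ∫ θ in (0 : ℝ)..(2 * Real.pi), f θ := by
  rw [thetaM, integral_smul_measure, intervalIntegral.integral_of_le (by positivity),
    integral_Ico_eq_integral_Ioc, ENNReal.toReal_ofReal (by positivity), smul_eq_mul]

lemma integrable_thetaM {f : ℝ → ℝ} (hf : Continuous f) : Integrable f thetaM :=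
  ((hf.integrableOn_Icc (a := 0) (b := 2 * Real.pi)).mono_set Ico_subset_Icc_self).smul_measure
    ENNReal.ofReal_ne_top

lemma eint_thetaM_disc {n : ℕ} {U : Set (En n)} {g : En n → ℝ} (hg : ContinuousOn g U)
    {z w : En n} (h : ∀ ζ : ℂ, ‖ζ‖ ≤ 1 → z + ζ • w ∈ U) :
    eint thetaM (fun θ => (g (z + circleMap 0 1 θ • w) : EReal)) =
      ((Real.circleAverage (fun ζ => g (z + ζ • w)) 0 1 : ℝ) : EReal) := by
  rw [eint_coe (f := fun θ => g (z + circleMap 0 1 θ • w)), integral_thetaM]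
  · simp [Real.circleAverage]
  · refine integrable_thetaM ?_
    exact (continuousOn_disc hg h).comp_continuous (continuous_circleMap 0 1) fun θ => by
      simp

lemma PshR.pshOnE {n : ℕ} {U : Set (En n)} {g : En n → ℝ} (hg : PshR U g) :
    PshOnE (fun x => (g x : EReal)) U := by
  refine ⟨(continuous_coe_real_ereal.comp_continuousOn hg.1).upperSemicontinuousOn,
    fun z _ => EReal.coe_lt_top _, fun z hz w r hr hw => ?_⟩
  have hw' : ∀ ζ : ℂ, ‖ζ‖ ≤ 1 → z + ζ • ((r : ℂ) • w) ∈ U := fun ζ hζ => by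
    rw [smul_smul]
    refine hw _ ?_
    rw [norm_mul, Complex.norm_real, Real.norm_of_nonneg hr.le]
    nlinarith
  have h1 := eint_thetaM_disc hg.1 hw'
  have h2 : ∀ θ, circleMap 0 1 θ • (r : ℂ) • w = circleMap 0 r θ • w := fun θ => by
    rw [smul_smul]; congr 1; simp [circleMap, mul_comm]
  simp only [h2] at h1
  rw [h1]
  exact EReal.coe_le_coe_iff.2 (hg.2 z hz _ hw')

/-- `u` cut off from below at the level `c`. -/
noncomputable def truncR {α : Type*} (c : ℝ) (u : α → EReal) (x : α) : ℝ := (max (u x) c).toReal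

lemma coe_truncR {α : Type*} {c : ℝ} {u : α → EReal} {x : α} (h : u x < ⊤) :
    ((truncR c u x : ℝ) : EReal) = max (u x) c :=
  EReal.coe_toReal (max_lt h (EReal.coe_lt_top c)).ne
    ((EReal.bot_lt_coe c).trans_le (le_max_right _ _)).ne'

lemma le_truncR {α : Type*} {c : ℝ} {u : α → EReal} {x : α} (h : u x < ⊤) : c ≤ truncR c u x := by
  rw [← EReal.coe_le_coe_iff, coe_truncR h]
  exact le_max_right _ _

lemma le_coe_truncR {α : Type*} {c : ℝ} {u : α → EReal} {x : α} (h : u x < ⊤) :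
    u x ≤ truncR c u x := by
  rw [coe_truncR h]
  exact le_max_left _ _

lemma continuousOn_truncR {α : Type*} [TopologicalSpace α] {c : ℝ} {u : α → EReal} {K : Set α}
    (hu : ContinuousOn u K) (h : ∀ x ∈ K, u x < ⊤) : ContinuousOn (truncR c u) K := by
  refine EReal.continuousOn_toReal.comp (hu.sup continuousOn_const) fun x hx => ?_
  have h1 : max (u x) (c : EReal) ≠ ⊤ := (max_lt (h x hx) (EReal.coe_lt_top c)).ne
  have h2 : max (u x) (c : EReal) ≠ ⊥ :=
    ((EReal.bot_lt_coe c).trans_le (le_max_right _ _)).ne'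
  simp only [mem_compl_iff, mem_insert_iff, mem_singleton_iff, not_or]
  exact ⟨h2, h1⟩

lemma tendsto_epos_neg_max (x : EReal) :
    Tendsto (fun N : ℕ => epos (-(max x ((-(N : ℝ) : ℝ) : EReal)))) atTop (𝓝 (epos (-x))) := by
  induction x with
  | bot =>
    have : ∀ N : ℕ, epos (-(max ⊥ ((-(N : ℝ) : ℝ) : EReal))) = ENNReal.ofReal N := fun N => by
      rw [max_eq_right bot_le, ← EReal.coe_neg, neg_neg, epos_coe]
    simp only [this]
    simpa [epos] using ENNReal.tendsto_nat_nhds_top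
  | top => simp
  | coe x =>
    obtain ⟨M, hM⟩ := exists_nat_ge (-x)
    refine tendsto_const_nhds.congr' ?_
    filter_upwards [eventually_ge_atTop M] with N hN
    rw [max_eq_left]
    have : (M : ℝ) ≤ N := by exact_mod_cast hN
    exact EReal.coe_le_coe_iff.2 (by linarith)

lemma le_eint_of_le_eint_max {α : Type*} [MeasurableSpace α] {μ : Measure α} {u : α → EReal}
    (hu : AEMeasurable u μ) (hP : ∫⁻ x, epos (u x) ∂μ ≠ ⊤) {a : EReal}
    (h : ∀ N : ℕ, a ≤ eint μ (fun x => max (u x) ((-(N : ℝ) : ℝ) : EReal))) : a ≤ eint μ u := by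
  have hm : Measurable epos := epos_mono.measurable
  have hlim : Tendsto (fun N : ℕ => ∫⁻ x, epos (-(max (u x) ((-(N : ℝ) : ℝ) : EReal))) ∂μ) atTop
      (𝓝 (∫⁻ x, epos (-(u x)) ∂μ)) := by
    refine lintegral_tendsto_of_tendsto_of_monotone (fun N => ?_) (ae_of_all _ fun x => ?_)
      (ae_of_all _ fun x => tendsto_epos_neg_max (u x))
    · exact hm.comp_aemeasurable (hu.max aemeasurable_const).neg
    · intro N M hNM
      have : (N : ℝ) ≤ M := by exact_mod_cast hNM
      exact epos_mono (EReal.neg_le_neg_iff.2 (max_le_max le_rfl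
        (EReal.coe_le_coe_iff.2 (by linarith))))
  have hpos : ∀ N : ℕ, ∫⁻ x, epos (max (u x) ((-(N : ℝ) : ℝ) : EReal)) ∂μ =
      ∫⁻ x, epos (u x) ∂μ := fun N => by
    refine lintegral_congr fun x => ?_
    rw [epos_mono.map_max, epos_coe, ENNReal.ofReal_of_nonpos (by simp), max_eq_left (zero_le)]
  refine ge_of_tendsto' (a := eint μ u) (x := atTop) ?_ h
  simp only [eint, hpos]
  set P := ∫⁻ x, epos (u x) ∂μ
  have h1 : Tendsto (fun N : ℕ => ((P : EReal),
      -((∫⁻ x, epos (-(max (u x) ((-(N : ℝ) : ℝ) : EReal))) ∂μ : ℝ≥0∞) : EReal))) atTop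
      (𝓝 ((P : EReal), -((∫⁻ x, epos (-(u x)) ∂μ : ℝ≥0∞) : EReal))) :=
    tendsto_const_nhds.prodMk_nhds
      ((continuous_neg.tendsto _).comp ((continuous_coe_ennreal_ereal.tendsto _).comp hlim))
  have h2 := EReal.continuousAt_add
    (p := ((P : EReal), -((∫⁻ x, epos (-(u x)) ∂μ : ℝ≥0∞) : EReal)))
    (.inl (by simpa using hP)) (.inl (by simp))
  exact h2.tendsto.comp h1

lemma integrable_of_continuousOn {n : ℕ} {X : Set (En n)} (hX : IsCompact X) {μ : Measure (En n)}
    [IsFiniteMeasure μ] (hμ : μ Xᶜ = 0) {g : En n → ℝ} (hg : ContinuousOn g X) :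
    Integrable g μ := by
  have h := hg.integrableOn_compact (μ := μ) hX
  rwa [IntegrableOn, Measure.restrict_eq_self_of_ae_mem (mem_ae_iff.2 hμ)] at h

lemma aemeasurable_of_continuousOn {n : ℕ} {X : Set (En n)} (hX : IsCompact X)
    {μ : Measure (En n)} (hμ : μ Xᶜ = 0) {u : En n → EReal} (hu : ContinuousOn u X) :
    AEMeasurable u μ := by
  have h := hu.aemeasurable (μ := μ) hX.measurableSet
  rwa [Measure.restrict_eq_self_of_ae_mem (mem_ae_iff.2 hμ)] at h

/-- Functions that are continuous and plurisubharmonic on a neighborhood of `X`. -/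
def NearPsh {n : ℕ} (X : Set (En n)) (g : En n → ℝ) : Prop :=
  ∃ U, IsOpen U ∧ X ⊆ U ∧ PshR U g

namespace NearPsh

variable {n : ℕ} {X : Set (En n)} {f g : En n → ℝ}

lemma continuousOn (h : NearPsh X g) : ContinuousOn g X := by
  obtain ⟨U, _, hXU, hg⟩ := h
  exact hg.1.mono hXU

lemma const (X : Set (En n)) (c : ℝ) : NearPsh X fun _ => c :=
  ⟨univ, isOpen_univ, subset_univ X, PshR.const _ c⟩

lemma add (hf : NearPsh X f) (hg : NearPsh X g) : NearPsh X fun x => f x + g x := by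
  obtain ⟨U, hU, hXU, hf⟩ := hf
  obtain ⟨V, hV, hXV, hg⟩ := hg
  exact ⟨U ∩ V, hU.inter hV, subset_inter hXU hXV,
    (hf.mono inter_subset_left).add (hg.mono inter_subset_right)⟩

lemma sup (hf : NearPsh X f) (hg : NearPsh X g) : NearPsh X fun x => max (f x) (g x) := by
  obtain ⟨U, hU, hXU, hf⟩ := hf
  obtain ⟨V, hV, hXV, hg⟩ := hg
  exact ⟨U ∩ V, hU.inter hV, subset_inter hXU hXV,
    (hf.mono inter_subset_left).sup (hg.mono inter_subset_right)⟩

lemma const_mul (hf : NearPsh X f) {c : ℝ} (hc : 0 ≤ c) : NearPsh X fun x => c * f x := by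
  obtain ⟨U, hU, hXU, hf⟩ := hf
  exact ⟨U, hU, hXU, hf.const_mul hc⟩

lemma le_integral (hX : IsCompact X) (hg : NearPsh X g) {z : En n} {μ : Measure (En n)}
    (hμ : IsJensen X z μ) : g z ≤ ∫ x, g x ∂μ := by
  have hgc := hg.continuousOn
  obtain ⟨U, hU, hXU, hg⟩ := hg
  have := hμ.1
  have h := hμ.2.2 U hU hXU (fun x => (g x : EReal))
    (continuous_coe_real_ereal.comp_continuousOn hg.1) hg.pshOnE
  rw [eint_coe (integrable_of_continuousOn hX hμ.2.1 hgc)] at h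
  exact EReal.coe_le_coe_iff.1 h

end NearPsh

lemma pshR_truncR {n : ℕ} {U : Set (En n)} {u : En n → EReal} (hc : ContinuousOn u U)
    (hu : PshOnE u U) (c : ℝ) : PshR U (truncR c u) := by
  have hcont : ContinuousOn (truncR c u) U := continuousOn_truncR hc hu.2.1
  refine ⟨hcont, fun z hz w hw => ?_⟩
  rw [← EReal.coe_le_coe_iff, coe_truncR (hu.2.1 z hz)]
  refine max_le ?_ ?_
  · refine (hu.2.2 z hz w 1 one_pos hw).trans ?_
    rw [← eint_thetaM_disc hcont hw]
    exact eint_mono_ae (ae_of_all _ fun θ => le_coe_truncR (hu.2.1 _ (hw _ (by simp))))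
  · refine EReal.coe_le_coe_iff.2 ((Real.circleAverage_const c 0 1).ge.trans
      (Real.circleAverage_mono continuousOn_const.circleIntegrable'
        (circleIntegrable_disc hcont hw) fun ζ hζ => ?_))
    exact le_truncR (hu.2.1 _ (hw ζ (by simpa using (mem_sphere_zero_iff_norm.1 hζ).le)))

lemma isJensen_of_nearPsh {n : ℕ} {X : Set (En n)} (hX : IsCompact X) {z : En n} (hz : z ∈ X)
    {μ : Measure (En n)} [IsProbabilityMeasure μ] (hμ : μ Xᶜ = 0)
    (h : ∀ g, NearPsh X g → g z ≤ ∫ x, g x ∂μ) : IsJensen X z μ := by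
  refine ⟨inferInstance, hμ, fun U hU hXU u hc hu => ?_⟩
  have hae : ∀ᵐ x ∂μ, x ∈ X := mem_ae_iff.2 hμ
  have hlt : ∀ x ∈ X, u x < ⊤ := fun x hx => hu.2.1 x (hXU hx)
  have hint : ∀ c, Integrable (truncR c u) μ := fun c =>
    integrable_of_continuousOn hX hμ (continuousOn_truncR (hc.mono hXU) hlt)
  refine le_eint_of_le_eint_max (aemeasurable_of_continuousOn hX hμ (hc.mono hXU)) ?_ fun N => ?_
  · refine ((lintegral_mono_ae ?_).trans_lt (hint 0).lintegral_lt_top).ne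
    filter_upwards [hae] with x hx
    rw [← epos_coe]
    exact epos_mono (le_coe_truncR (hlt x hx))
  · have h1 := h _ ⟨U, hU, hXU, pshR_truncR hc hu (-N)⟩
    rw [← EReal.coe_le_coe_iff, ← eint_coe (hint _)] at h1
    refine (le_coe_truncR (hlt z hz)).trans (h1.trans_eq (eint_congr_ae ?_))
    filter_upwards [hae] with x hx using coe_truncR (hlt x hx)

lemma pshcR_iff {n : ℕ} {X : Set (En n)} (hX : IsCompact X) {g : En n → ℝ} :
    PSHcR X g ↔ ContinuousOn g X ∧
      ∀ z ∈ X, ∀ μ : Measure (En n), IsJensen X z μ → g z ≤ ∫ x, g x ∂μ := by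
  refine and_congr_right fun hg => ⟨fun h z hz μ hμ => ?_, fun h =>
    ⟨(continuous_coe_real_ereal.comp_continuousOn hg).upperSemicontinuousOn,
    fun z _ => EReal.coe_lt_top _, fun z hz μ hμ => ?_⟩⟩
  all_goals have := hμ.1
  · have h1 := h.2.2 z hz μ hμ
    rw [eint_coe (integrable_of_continuousOn hX hμ.2.1 hg)] at h1
    exact EReal.coe_le_coe_iff.1 h1
  · rw [eint_coe (integrable_of_continuousOn hX hμ.2.1 hg)]
    exact EReal.coe_le_coe_iff.2 (h z hz μ hμ)

lemma NearPsh.pshcR {n : ℕ} {X : Set (En n)} (hX : IsCompact X) {g : En n → ℝ}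
    (hg : NearPsh X g) : PSHcR X g :=
  (pshcR_iff hX).2 ⟨hg.continuousOn, fun _ _ _ hμ => hg.le_integral hX hμ⟩

lemma PSHcR.sup {n : ℕ} {X : Set (En n)} (hX : IsCompact X) {f g : En n → ℝ}
    (hf : PSHcR X f) (hg : PSHcR X g) : PSHcR X fun x => max (f x) (g x) := by
  have hc : ContinuousOn (fun x => max (f x) (g x)) X := hf.1.sup hg.1
  refine (pshcR_iff hX).2 ⟨hc, fun z hz μ hμ => ?_⟩
  have := hμ.1
  have hi : ∀ {h : En n → ℝ}, ContinuousOn h X → Integrable h μ := fun h =>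
    integrable_of_continuousOn hX hμ.2.1 h
  exact max_le
    ((((pshcR_iff hX).1 hf).2 z hz μ hμ).trans
      (integral_mono (hi hf.1) (hi hc) fun x => le_max_left _ _))
    ((((pshcR_iff hX).1 hg).2 z hz μ hμ).trans
      (integral_mono (hi hg.1) (hi hc) fun x => le_max_right _ _))

lemma PSHce.truncR {n : ℕ} {X : Set (En n)} (hX : IsCompact X) {u : En n → EReal}
    (hu : PSHce X u) (c : ℝ) : PSHcR X (truncR c u) := by
  have hc : ContinuousOn (_root_.truncR c u) X := continuousOn_truncR hu.2 hu.1.2.1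
  refine (pshcR_iff hX).2 ⟨hc, fun z hz μ hμ => ?_⟩
  have := hμ.1
  have hae : ∀ᵐ x ∂μ, x ∈ X := mem_ae_iff.2 hμ.2.1
  have hi := integrable_of_continuousOn hX hμ.2.1 hc
  rw [← EReal.coe_le_coe_iff, coe_truncR (hu.1.2.1 z hz)]
  refine max_le ?_ (EReal.coe_le_coe_iff.2 ?_)
  · rw [← eint_coe hi]
    refine (hu.1.2.2 z hz μ hμ).trans (eint_mono_ae ?_)
    filter_upwards [hae] with x hx using le_coe_truncR (hu.1.2.1 x hx)
  · have : ∫ _, c ∂μ ≤ ∫ x, _root_.truncR c u x ∂μ := by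
      refine integral_mono_ae (integrable_const c) hi ?_
      filter_upwards [hae] with x hx using le_truncR (hu.1.2.1 x hx)
    simpa using this

lemma PSHcR.pshce {n : ℕ} {X : Set (En n)} {g : En n → ℝ} (hg : PSHcR X g) :
    PSHce X fun x => (g x : EReal) :=
  ⟨hg.2, continuous_coe_real_ereal.comp_continuousOn hg.1⟩

lemma PSHce.mono {n : ℕ} {K X : Set (En n)} (hKX : K ⊆ X) {u : En n → EReal} (hu : PSHce X u) :
    PSHce K u :=
  ⟨⟨hu.1.1.mono hKX, fun z hz => hu.1.2.1 z (hKX hz), fun z hz μ hμ =>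
    hu.1.2.2 z (hKX hz) μ ⟨hμ.1, measure_mono_null (compl_subset_compl.2 hKX) hμ.2.1,
      fun U hU hXU => hμ.2.2 U hU (hKX.trans hXU)⟩⟩, hu.2.mono hKX⟩

/-- The upper envelope functional at `z`: the infimum of `-g z` over all `g` plurisubharmonic near
`X` with `f ≤ -g` on `X`. -/
noncomputable def envelope {n : ℕ} (X : Set (En n)) (z : En n) (f : C(X, ℝ)) : ℝ :=
  sInf {t | ∃ g, NearPsh X g ∧ (∀ x : X, f x ≤ -g x) ∧ t = -g z}

section envelope

variable {n : ℕ} {X : Set (En n)} {z : En n}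

lemma envelope_le (hz : z ∈ X) {f : C(X, ℝ)} {g : En n → ℝ} (hg : NearPsh X g)
    (h : ∀ x : X, f x ≤ -g x) : envelope X z f ≤ -g z :=
  csInf_le ⟨f ⟨z, hz⟩, by rintro t ⟨g, _, h, rfl⟩; exact h ⟨z, hz⟩⟩ ⟨g, hg, h, rfl⟩

variable [CompactSpace X]

lemma le_envelope {f : C(X, ℝ)} {c : ℝ}
    (h : ∀ g, NearPsh X g → (∀ x : X, f x ≤ -g x) → c ≤ -g z) : c ≤ envelope X z f := by
  refine le_csInf ⟨_, fun _ => -‖f‖, NearPsh.const X _, fun x => ?_, rfl⟩ ?_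
  · rw [neg_neg]
    exact (le_abs_self _).trans (f.norm_coe_le_norm x)
  · rintro t ⟨g, hg, hfg, rfl⟩
    exact h g hg hfg

lemma envelope_smul_le (hz : z ∈ X) {c : ℝ} (hc : 0 < c) (f : C(X, ℝ)) :
    envelope X z (c • f) ≤ c * envelope X z f := by
  rw [← div_le_iff₀' hc]
  refine le_envelope fun g hg hfg => ?_
  rw [div_le_iff₀' hc, mul_neg]
  refine envelope_le hz (hg.const_mul hc.le) fun x => ?_
  have := mul_le_mul_of_nonneg_left (hfg x) hc.le
  simpa using this

lemma envelope_smul (hz : z ∈ X) {c : ℝ} (hc : 0 < c) (f : C(X, ℝ)) :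
    envelope X z (c • f) = c * envelope X z f := by
  refine le_antisymm (envelope_smul_le hz hc f) ?_
  have := envelope_smul_le hz (inv_pos.2 hc) (c • f)
  rw [smul_smul, inv_mul_cancel₀ hc.ne', one_smul] at this
  rwa [← div_eq_inv_mul, le_div_iff₀' hc] at this

lemma envelope_add_le (hz : z ∈ X) (f₁ f₂ : C(X, ℝ)) :
    envelope X z (f₁ + f₂) ≤ envelope X z f₁ + envelope X z f₂ := by
  rw [← sub_le_iff_le_add]
  refine le_envelope fun g₁ hg₁ h₁ => ?_
  rw [sub_le_comm]
  refine le_envelope fun g₂ hg₂ h₂ => ?_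
  have := envelope_le hz (f := f₁ + f₂) (hg₁.add hg₂) fun x => by
    have := h₁ x
    have := h₂ x
    simp only [ContinuousMap.add_apply]
    linarith
  linarith

lemma envelope_zero (hz : z ∈ X) : envelope X z 0 = 0 := by
  have := envelope_smul (c := 2) hz two_pos (0 : C(X, ℝ))
  rw [smul_zero] at this
  linarith

/-- A linear functional touching the envelope functional at a prescribed function. -/
lemma exists_linear_le_envelope (hz : z ∈ X) (f : C(X, ℝ)) :
    ∃ L : C(X, ℝ) →ₗ[ℝ] ℝ, L f = envelope X z f ∧ ∀ g, L g ≤ envelope X z g := by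
  have H : ∀ c : ℝ, c • f = 0 → c • envelope X z f = 0 := fun c hc => by
    rcases smul_eq_zero.1 hc with rfl | rfl
    · exact zero_smul ℝ _
    · rw [envelope_zero hz, smul_zero]
  have hle : ∀ x : (LinearPMap.mkSpanSingleton' (σ := RingHom.id ℝ) f (envelope X z f) H).domain,
      LinearPMap.mkSpanSingleton' (σ := RingHom.id ℝ) f (envelope X z f) H x ≤ envelope X z x := by
    rintro ⟨x, hx⟩
    obtain ⟨c, rfl⟩ := Submodule.mem_span_singleton.1 hx
    rw [LinearPMap.mkSpanSingleton'_apply]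
    change c * envelope X z f ≤ envelope X z (c • f)
    rcases lt_trichotomy c 0 with hc | rfl | hc
    · have h1 := envelope_add_le hz (c • f) ((-c) • f)
      rw [envelope_smul hz (neg_pos.2 hc), ← add_smul, add_neg_cancel, zero_smul,
        envelope_zero hz] at h1
      linarith
    · simp [envelope_zero hz]
    · exact (envelope_smul hz hc f).ge
  obtain ⟨L, hL, hLe⟩ := exists_extension_of_le_sublinear _ (envelope X z)
    (fun c hc f => envelope_smul hz hc f) (envelope_add_le hz) hle
  exact ⟨L, (hL ⟨f, Submodule.mem_span_singleton_self f⟩).trans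
    (LinearPMap.mkSpanSingleton'_apply_self _ _ _ _), hLe⟩

end envelope

/-- Edwards' theorem: some Jensen measure computes the lower plurisubharmonic envelope. -/
lemma exists_isJensen_integral_le {n : ℕ} {X : Set (En n)} (hX : IsCompact X) {z : En n}
    (hz : z ∈ X) {f : En n → ℝ} (hf : ContinuousOn f X) {c : ℝ}
    (h : ∀ g, NearPsh X g → (∀ x ∈ X, g x ≤ f x) → g z ≤ c) :
    ∃ μ, IsJensen X z μ ∧ ∫ x, f x ∂μ ≤ c := by
  have : CompactSpace X := isCompact_iff_compactSpace.1 hX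
  let F : C(X, ℝ) := ⟨fun x => f x, hf.comp_continuous continuous_subtype_val fun x => x.2⟩
  obtain ⟨L, hLF, hL⟩ := exists_linear_le_envelope hz (-F)
  have hpos : ∀ g : C(X, ℝ), 0 ≤ g → 0 ≤ L g := fun g hg => by
    have h1 := (hL (-g)).trans (envelope_le hz (NearPsh.const X 0) fun x => by
      simpa using hg x)
    rw [map_neg] at h1
    linarith
  have hone : L 1 = 1 := by
    have h1 := (hL 1).trans (envelope_le hz (NearPsh.const X (-1)) fun x => by simp)
    have h2 := (hL (-1)).trans (envelope_le hz (NearPsh.const X 1) fun x => by simp)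
    rw [map_neg] at h2
    linarith
  let Λ : CompactlySupportedContinuousMap X ℝ →ₚ[ℝ] ℝ := PositiveLinearMap.mk₀
    { toFun := fun g => L g.toContinuousMap
      map_add' := fun g₁ g₂ => L.map_add g₁.toContinuousMap g₂.toContinuousMap
      map_smul' := fun a g => L.map_smul a g.toContinuousMap } fun g hg => hpos _ hg
  set ν := RealRMK.rieszMeasure Λ
  have hνL : ∀ g : C(X, ℝ), ∫ x, g x ∂ν = L g := fun g =>
    RealRMK.integral_rieszMeasure Λ ⟨g, HasCompactSupport.of_compactSpace _⟩
  have hνp : IsProbabilityMeasure ν := by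
    have h1 := hνL 1
    rw [hone] at h1
    simp only [ContinuousMap.one_apply, integral_const, smul_eq_mul, mul_one] at h1
    exact ⟨(ENNReal.toReal_eq_one_iff _).1 h1⟩
  have hemb : MeasurableEmbedding (Subtype.val : X → En n) :=
    MeasurableEmbedding.subtype_coe hX.measurableSet
  have hμp : IsProbabilityMeasure (ν.map Subtype.val) :=
    Measure.isProbabilityMeasure_map measurable_subtype_coe.aemeasurable
  refine ⟨ν.map Subtype.val, isJensen_of_nearPsh hX hz ?_ fun g hg => ?_, ?_⟩
  · rw [hemb.map_apply]
    simp
  · let G : C(X, ℝ) := ⟨fun x => g x, hg.continuousOn.comp_continuous continuous_subtype_val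
      fun x => x.2⟩
    rw [hemb.integral_map]
    have h1 := (hL (-G)).trans (envelope_le hz hg fun x => le_rfl)
    rw [map_neg, ← hνL G] at h1
    exact neg_le_neg_iff.1 h1
  · rw [hemb.integral_map]
    have h1 : -c ≤ envelope X z (-F) := le_envelope fun g hg hfg => neg_le_neg
      (h g hg fun x hx => by simpa [F] using hfg ⟨x, hx⟩)
    rw [← hLF, map_neg, ← hνL F] at h1
    exact neg_le_neg_iff.1 h1

/-- A form of Dini's theorem: pointwise strict minorization by a family stable under maxima is
uniform on compact sets. -/
lemma IsCompact.exists_forall_lt_of_directed {α : Type*} [TopologicalSpace α] {K : Set α}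
    (hK : IsCompact K) {S : Set (α → ℝ)} (hne : S.Nonempty)
    (hS : ∀ g₁ ∈ S, ∀ g₂ ∈ S, (fun x => max (g₁ x) (g₂ x)) ∈ S) {f : α → ℝ}
    (hf : ContinuousOn f K) (hg : ∀ g ∈ S, ContinuousOn g K)
    (h : ∀ z ∈ K, ∃ g ∈ S, f z < g z) : ∃ g ∈ S, ∀ x ∈ K, f x < g x := by
  suffices H : ∃ g ∈ S, ∀ x ∈ K, x ∈ K → f x < g x by
    obtain ⟨g, hgS, h⟩ := H
    exact ⟨g, hgS, fun x hx => h x hx hx⟩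
  refine hK.induction_on (p := fun s => ∃ g ∈ S, ∀ x ∈ s, x ∈ K → f x < g x) ?_ ?_ ?_ ?_
  · obtain ⟨g, hgS⟩ := hne
    exact ⟨g, hgS, fun x hx => hx.elim⟩
  · rintro s t hst ⟨g, hgS, h⟩
    exact ⟨g, hgS, fun x hx => h x (hst hx)⟩
  · rintro s t ⟨g₁, h₁S, h₁⟩ ⟨g₂, h₂S, h₂⟩
    refine ⟨_, hS g₁ h₁S g₂ h₂S, fun x hx hxK => ?_⟩
    rcases hx with hx | hx
    · exact (h₁ x hx hxK).trans_le (le_max_left _ _)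
    · exact (h₂ x hx hxK).trans_le (le_max_right _ _)
  · intro z hz
    obtain ⟨g, hgS, hlt⟩ := h z hz
    exact ⟨{x | f x < g x}, (hf z hz).eventually_lt (hg g hgS z hz) hlt, g, hgS,
      fun x hx _ => hx⟩

/-- A plurisubharmonic function on `X` is approximated uniformly from below by functions
plurisubharmonic near `X`. -/
lemma PSHcR.exists_nearPsh {n : ℕ} {X : Set (En n)} (hX : IsCompact X) {f : En n → ℝ}
    (hf : PSHcR X f) {ε : ℝ} (hε : 0 < ε) :
    ∃ g, NearPsh X g ∧ ∀ x ∈ X, g x ≤ f x ∧ f x - ε < g x := by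
  let S : Set (En n → ℝ) := {g | NearPsh X g ∧ ∀ x ∈ X, g x ≤ f x}
  obtain ⟨C, hC⟩ := hX.bddBelow_image hf.1
  have hne : S.Nonempty :=
    ⟨fun _ => C, NearPsh.const X C, fun x hx => hC (mem_image_of_mem f hx)⟩
  obtain ⟨g, hg, hlt⟩ := hX.exists_forall_lt_of_directed (f := fun x => f x - ε) hne
    (fun g₁ h₁ g₂ h₂ => ⟨h₁.1.sup h₂.1, fun x hx => max_le (h₁.2 x hx) (h₂.2 x hx)⟩)
    (hf.1.sub continuousOn_const) (fun g hg => hg.1.continuousOn) fun z hz => by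
      by_contra! hcon
      obtain ⟨μ, hμ, hle⟩ := exists_isJensen_integral_le hX hz hf.1 (c := f z - ε)
        fun g hg hgf => hcon g ⟨hg, hgf⟩
      have := ((pshcR_iff hX).1 hf).2 z hz μ hμ
      linarith
  exact ⟨g, hg.1, fun x hx => ⟨hg.2 x hx, hlt x hx⟩⟩

/-- Gluing: if `g < h` on the relative boundary of `X ∩ W`, then `max g h` on `X ∩ W` extended
by `h` is, up to a uniform error, plurisubharmonic near `X`. -/
lemma exists_nearPsh_glue {n : ℕ} {X W : Set (En n)} (hX : IsCompact X) (hW : IsOpen W)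
    {g h : En n → ℝ} (hg : PSHcR (closure (X ∩ W)) g) (hh : PSHcR X h)
    (hlt : ∀ x ∈ closure (X ∩ W) \ (X ∩ W), g x < h x) {ε : ℝ} (hε : 0 < ε) :
    ∃ F, NearPsh X F ∧ (∀ x ∈ X ∩ W, g x - ε ≤ F x) ∧ ∀ x ∈ X \ W, F x ≤ h x := by
  set V := X ∩ W with hV
  have hVX : closure V ⊆ X := closure_minimal inter_subset_left hX.isClosed
  have hVc : IsCompact (closure V) := hX.of_isClosed_subset isClosed_closure hVX
  have hbd : closure V \ V = closure V \ W := by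
    ext x
    exact ⟨fun hx => ⟨hx.1, fun hxW => hx.2 ⟨hVX hx.1, hxW⟩⟩, fun hx => ⟨hx.1, fun h => hx.2 h.2⟩⟩
  have hbdc : IsCompact (closure V \ V) := by
    rw [hbd]
    exact hVc.diff hW
  obtain ⟨δ, hδ, hδε, hδh⟩ : ∃ δ > 0, δ ≤ ε ∧ ∀ x ∈ closure V \ V, g x + δ ≤ h x := by
    rcases (closure V \ V).eq_empty_or_nonempty with he | hne
    · exact ⟨ε, hε, le_rfl, by simp [he]⟩
    · obtain ⟨x₀, hx₀, hmin⟩ := hbdc.exists_isMinOn hne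
        ((hh.1.mono (sdiff_subset.trans hVX)).sub (hg.1.mono sdiff_subset))
      refine ⟨min ε (h x₀ - g x₀), lt_min hε (sub_pos.2 (hlt x₀ hx₀)), min_le_left _ _,
        fun x hx => ?_⟩
      have h1 : h x₀ - g x₀ ≤ h x - g x := hmin hx
      have h2 := min_le_right ε (h x₀ - g x₀)
      linarith
  obtain ⟨g', ⟨Ug, hUg, hVUg, hg'⟩, hgg'⟩ := hg.exists_nearPsh hVc hδ
  obtain ⟨h', ⟨Uh, hUh, hXUh, hh'⟩, hhh'⟩ := hh.exists_nearPsh hX hδ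
  have hlt' : ∀ x ∈ closure V \ V, g' x < h' x := fun x hx => by
    have h1 := (hgg' x hx.1).1
    have h2 := (hhh' x (hVX hx.1)).2
    have h3 := hδh x hx
    linarith
  obtain ⟨O₁, O₃, hO₁, hO₃, hVO₁, hXO₃, hdisj⟩ : SeparatedNhds V (X \ closure V) := by
    refine separatedNhds_iff_disjoint.2 (completely_normal disjoint_sdiff_right ?_)
    have hsub : closure (X \ closure V) ⊆ X \ W := by
      refine closure_minimal (fun x hx => ⟨hx.1, fun hxW => hx.2 (subset_closure ⟨hx.1, hxW⟩)⟩) ?_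
      exact (hX.diff hW).isClosed
    exact disjoint_left.2 fun x hx hx' => (hsub hx').2 hx.2
  classical
  set A : Set (En n) := O₁ ∩ (Ug ∩ Uh) with hA
  have hAo : IsOpen A := hO₁.inter (hUg.inter hUh)
  set B : Set (En n) := {x ∈ Ug ∩ Uh | g' x < h' x} with hB
  have hBo : IsOpen B := by
    have hc : ContinuousOn (fun x => h' x - g' x) (Ug ∩ Uh) :=
      (hh'.1.mono inter_subset_right).sub (hg'.1.mono inter_subset_left)
    have := hc.isOpen_inter_preimage (hUg.inter hUh) (isOpen_Ioi (a := 0))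
    convert this using 1
    ext x
    simp only [hB, mem_inter_iff, mem_ofPred_eq, mem_preimage, mem_Ioi, sub_pos]
  set C : Set (En n) := O₃ ∩ Uh with hC
  have hCo : IsOpen C := hO₃.inter hUh
  set F : En n → ℝ := fun x => if x ∈ O₁ then max (g' x) (h' x) else h' x with hF
  refine ⟨F, ⟨A ∪ B ∪ C, (hAo.union hBo).union hCo, ?_, ?_⟩, ?_, ?_⟩
  · intro x hx
    by_cases hxV : x ∈ V
    · exact .inl (.inl ⟨hVO₁ hxV, hVUg (subset_closure hxV), hXUh hx⟩)
    · by_cases hxc : x ∈ closure V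
      · exact .inl (.inr ⟨⟨hVUg hxc, hXUh hx⟩, hlt' x ⟨hxc, hxV⟩⟩)
      · exact .inr ⟨hXO₃ ⟨hx, hxc⟩, hXUh hx⟩
  · refine PshR.of_local fun z hz => ?_
    rcases hz with (hz | hz) | hz
    · refine ⟨A, hAo, hz, ((hg'.mono fun x hx => hx.2.1).sup (hh'.mono fun x hx => hx.2.2)).congr
        fun x hx => if_pos hx.1⟩
    · refine ⟨B, hBo, hz, (hh'.mono fun x hx => hx.1.2).congr fun x hx => ?_⟩
      simp only [hF, max_eq_right hx.2.le, ite_self]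
    · exact ⟨C, hCo, hz, (hh'.mono fun x hx => hx.2).congr fun x hx =>
        if_neg fun h => disjoint_left.1 hdisj h hx.1⟩
  · intro x hx
    have h1 := (hgg' x (subset_closure hx)).2
    simp only [hF, if_pos (hVO₁ hx)]
    have := le_max_left (g' x) (h' x)
    linarith
  · intro x hx
    refine le_trans (le_of_eq ?_) (hhh' x hx.1).1
    by_cases hxc : x ∈ closure V
    · simp only [hF, max_eq_right (hlt' x ⟨hxc, fun h => hx.2 h.2⟩).le, ite_self]
    · exact if_neg fun h => disjoint_left.1 hdisj h (hXO₃ ⟨hx.1, hxc⟩)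

section Dirichlet

variable {n : ℕ} {X : Set (En n)} {φ : En n → ℝ} {u : En n → EReal}

lemma PSHcR.sub_const (hX : IsCompact X) {g : En n → ℝ} (hg : PSHcR X g) (c : ℝ) :
    PSHcR X fun x => g x - c := by
  rw [pshcR_iff hX] at hg ⊢
  refine ⟨hg.1.sub continuousOn_const, fun z hz μ hμ => ?_⟩
  have := hμ.1
  rw [integral_sub (integrable_of_continuousOn hX hμ.2.1 hg.1) (integrable_const c),
    integral_const, probReal_univ, one_smul]
  exact sub_le_sub_right (hg.2 z hz μ hμ) c

lemma bset_subset (hX : IsCompact X) : Bset X ⊆ X :=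
  closure_minimal (fun _ hx => hx.1) hX.isClosed

/-- The upper envelope solving the Dirichlet problem takes the prescribed boundary values. -/
lemma dirichlet_eq_boundary (hX : IsCompact X) (hreg : IsClosed (Oset X))
    (hφ : ContinuousOn φ (Bset X))
    (hu : ∀ x, u x =
      ⨆ v ∈ {v : En n → EReal | PSHce X v ∧ ∀ w ∈ Bset X, v w ≤ (φ w : EReal)}, v x) :
    ∀ w ∈ Bset X, u w = (φ w : EReal) := by
  intro w hw
  refine le_antisymm ((hu w).trans_le (iSup₂_le fun v hv => hv.2 w hw)) ?_
  have hwO : w ∈ Oset X := hreg.closure_eq ▸ hw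
  obtain ⟨f, hf⟩ := ContinuousMap.exists_restrict_eq (isClosed_closure (s := Oset X))
    ⟨fun x : Bset X => φ x, hφ.comp_continuous continuous_subtype_val fun x => x.2⟩
  have hfφ : ∀ x ∈ Bset X, f x = φ x := fun x hx => DFunLike.congr_fun hf ⟨x, hx⟩
  have hBX := bset_subset hX
  by_contra! hlt
  obtain ⟨c, huc, hcφ⟩ := EReal.lt_iff_exists_real_btwn.1 hlt
  obtain ⟨μ, hμ, hle⟩ := exists_isJensen_integral_le hX hwO.1 f.continuous.continuousOn (c := c)
    fun g hg hgf => by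
      have h1 : ((g w : ℝ) : EReal) ≤ u w := by
        rw [hu w]
        exact le_iSup₂ (f := fun (v : En n → EReal) _ => v w) (fun x => (g x : EReal))
          ⟨(hg.pshcR hX).pshce, fun x hx => EReal.coe_le_coe_iff.2 (hfφ x hx ▸ hgf x (hBX hx))⟩
      exact EReal.coe_le_coe_iff.1 (h1.trans huc.le)
  rw [hwO.2 μ hμ, integral_dirac, hfφ w hw] at hle
  exact absurd (EReal.coe_lt_coe_iff.1 hcφ) hle.not_gt

/-- The upper envelope solving the Dirichlet problem is maximal. -/
lemma dirichlet_maximalOn (hX : IsCompact X) (hφ : ContinuousOn φ (Bset X))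
    (hu : ∀ x, u x =
      ⨆ v ∈ {v : En n → EReal | PSHce X v ∧ ∀ w ∈ Bset X, v w ≤ (φ w : EReal)}, v x) :
    MaximalOn X (Bset X) u := by
  intro W hW hXW v hv hvu x hx
  set V := X ∩ W with hV
  by_cases hxV : x ∉ V
  · exact hvu x ⟨hx, hxV⟩
  rw [not_not] at hxV
  have hBX := bset_subset hX
  have hVX : closure V ⊆ X := closure_minimal inter_subset_left hX.isClosed
  have hVc : IsCompact (closure V) := hX.of_isClosed_subset isClosed_closure hVX
  have hbdc : IsCompact (closure V \ V) := by
    have hbd : closure V \ V = closure V \ W := by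
      ext y
      exact ⟨fun hy => ⟨hy.1, fun hyW => hy.2 ⟨hVX hy.1, hyW⟩⟩,
        fun hy => ⟨hy.1, fun h => hy.2 h.2⟩⟩
    rw [hbd]
    exact hVc.diff hW
  have hcand : ∀ {g : En n → ℝ}, PSHcR X g → (∀ w ∈ Bset X, g w ≤ φ w) →
      ∀ y, (g y : EReal) ≤ u y := fun {g} hg hgφ y => by
    rw [hu y]
    exact le_iSup₂ (f := fun (v : En n → EReal) _ => v y) (fun y => (g y : EReal))
      ⟨hg.pshce, fun w hw => EReal.coe_le_coe_iff.2 (hgφ w hw)⟩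
  obtain ⟨C, hC⟩ := (hX.of_isClosed_subset isClosed_closure hBX).bddBelow_image hφ
  have hCφ : ∀ w ∈ Bset X, C ≤ φ w := fun w hw => hC (mem_image_of_mem φ hw)
  have hCX : PSHcR X fun _ => C := (NearPsh.const X C).pshcR hX
  by_contra! hlt
  have hg := hv.truncR hVc C
  obtain ⟨c, huc, hcg⟩ := EReal.lt_iff_exists_real_btwn.1
    (hlt.trans_le (le_coe_truncR (c := C) (hv.1.2.1 x hx)))
  set g := _root_.truncR C v
  have hgu : ∀ y ∈ closure V \ V, (g y : EReal) ≤ u y := fun y hy => by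
    rw [coe_truncR (hv.1.2.1 y hy.1)]
    exact max_le (hvu y hy) (hcand hCX hCφ y)
  rw [EReal.coe_lt_coe_iff] at hcg
  obtain ⟨ε, hε, hεc⟩ : ∃ ε > 0, g x - 2 * ε = c := ⟨(g x - c) / 2, by linarith, by ring⟩
  let S : Set (En n → ℝ) := {h | PSHcR X h ∧ ∀ w ∈ Bset X, h w ≤ φ w}
  obtain ⟨h, hhS, hgh⟩ := hbdc.exists_forall_lt_of_directed (S := S) (f := fun y => g y - ε)
    ⟨_, hCX, hCφ⟩
    (fun g₁ h₁ g₂ h₂ => ⟨h₁.1.sup hX h₂.1, fun w hw => max_le (h₁.2 w hw) (h₂.2 w hw)⟩)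
    ((hg.1.mono sdiff_subset).sub continuousOn_const)
    (fun g hg => hg.1.1.mono (sdiff_subset.trans hVX)) fun y hy => by
      have hyu : ((g y - ε : ℝ) : EReal) < u y :=
        (EReal.coe_lt_coe_iff.2 (sub_lt_self _ hε)).trans_le (hgu y hy)
      rw [hu y] at hyu
      obtain ⟨v', hv', hlt'⟩ := lt_biSup_iff.1 hyu
      refine ⟨_root_.truncR C v', ⟨hv'.1.truncR hX C, fun w hw => ?_⟩, ?_⟩
      · rw [← EReal.coe_le_coe_iff, coe_truncR (hv'.1.1.2.1 w (hBX hw))]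
        exact max_le (hv'.2 w hw) (EReal.coe_le_coe_iff.2 (hCφ w hw))
      · exact EReal.coe_lt_coe_iff.1
          (hlt'.trans_le (le_coe_truncR (hv'.1.1.2.1 y (hVX hy.1))))
  obtain ⟨F, hF, hgF, hFh⟩ := exists_nearPsh_glue hX hW (hg.sub_const hVc ε) hhS.1 hgh hε
  have hFu := hcand (hF.pshcR hX)
    (fun w hw => (hFh w ⟨hBX hw, fun hwW => (hXW ⟨hBX hw, hwW⟩).2 hw⟩).trans (hhS.2 w hw)) x
  have hcF : c ≤ F x := by
    have := hgF x hxV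
    linarith
  exact huc.not_ge ((EReal.coe_le_coe_iff.2 hcF).trans hFu)

end Dirichlet

/-- Theorem 6.3, part (6): uniqueness of the maximal solution of the Dirichlet problem. -/
theorem stmt_15 {n : ℕ} (X : Set (En n)) (hX : IsCompact X) (hreg : IsClosed (Oset X))
    (φ : En n → ℝ) (hφ : ContinuousOn φ (Bset X)) (u : En n → EReal)
    (hu : ∀ x, u x =
      ⨆ v ∈ {v : En n → EReal | PSHce X v ∧ ∀ w ∈ Bset X, v w ≤ (φ w : EReal)}, v x) :
    (PSHw X u ∧ MaximalOn X (Bset X) u ∧ ∀ w ∈ Bset X, u w = (φ w : EReal)) ∧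
    ∀ v : En n → EReal, PSHw X v → MaximalOn X (Bset X) v →
      (∀ w ∈ Bset X, v w = (φ w : EReal)) → ∀ x ∈ X, v x = u x := by
  have hb := dirichlet_eq_boundary hX hreg hφ hu
  have hBX := bset_subset hX
  have hcand : ∀ {v : En n → EReal}, PSHce X v → (∀ w ∈ Bset X, v w ≤ (φ w : EReal)) →
      ∀ x, v x ≤ u x := fun {v} hv hvφ x => by
    rw [hu x]
    exact le_iSup₂ (f := fun (v : En n → EReal) _ => v x) v ⟨hv, hvφ⟩
  refine ⟨⟨⟨_, ?_, fun v hv => hv.1, fun x _ => hu x⟩, dirichlet_maximalOn hX hφ hu, hb⟩,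
    fun v hv hmax hvφ x hx => le_antisymm ?_ ?_⟩
  · obtain ⟨C, hC⟩ := (hX.of_isClosed_subset isClosed_closure hBX).bddBelow_image hφ
    exact ⟨fun _ => (C : EReal), ((NearPsh.const X C).pshcR hX).pshce,
      fun w hw => EReal.coe_le_coe_iff.2 (hC (mem_image_of_mem φ hw))⟩
  · obtain ⟨F, -, hF, hvF⟩ := hv
    rw [hvF x hx]
    refine iSup₂_le fun f hf => hcand (hF f hf) (fun w hw => ?_) x
    rw [← hvφ w hw, hvF w (hBX hw)]
    exact le_iSup₂ (f := fun (f : En n → EReal) _ => f w) f hf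
  · rw [hu x]
    refine iSup₂_le fun f hf => ?_
    by_cases hxB : x ∈ Bset X
    · exact (hf.2 x hxB).trans_eq (hvφ x hxB).symm
    have hsub : closure (X ∩ (Bset X)ᶜ) ⊆ X := closure_minimal inter_subset_left hX.isClosed
    refine hmax (Bset X)ᶜ isClosed_closure.isOpen_compl subset_rfl f (hf.1.mono hsub)
      (fun w hw => ?_) x (subset_closure ⟨hx, hxB⟩)
    have hwB : w ∈ Bset X := by_contra fun h => hw.2 ⟨hsub hw.1, h⟩
    exact (hf.2 w hwB).trans_eq (hvφ w hwB).symm
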